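/- arXiv:2209.01539 — 2 statements merged into one kernel-verified Lean document; each statement's English description precedes it below -/
import Mathlib

section
/- Let C be a finite nonempty set of words, n a natural number, φ : C → ℝⁿ an embedding, and ε > 0. Define the randomized word-substitution mechanism M by Pr[M(x) = y] = exp(-½·ε·‖φ(x) − φ(y)‖) / (∑_{y' ∈ C} exp(-½·ε·‖φ(x) − φ(y')‖)), where ‖·‖ is the Euclidean norm. Then M satisfies metric differential privacy with respect to the embedding-induced distance: for all words x, x', y ∈ C, Pr[M(x) = y] ≤ exp(ε·‖φ(x) − φ(x')‖) · Pr[M(x') = y]. -/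
/-- Moving the centre of the exponential kernel from `b` to `a` costs at most a factor
`exp (½ε‖a - b‖)`. -/
theorem exp_kernel_le_mul {E : Type*} [SeminormedAddCommGroup E] {ε : ℝ} (hε : 0 ≤ ε)
    (a b z : E) :
    Real.exp (-(1/2) * ε * ‖a - z‖) ≤
      Real.exp (1/2 * ε * ‖a - b‖) * Real.exp (-(1/2) * ε * ‖b - z‖) := by
  rw [← Real.exp_add, Real.exp_le_exp]
  have h : ‖b - z‖ ≤ ‖a - b‖ + ‖a - z‖ := by
    simpa only [norm_sub_rev b a] using norm_sub_le_norm_sub_add_norm_sub b a z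
  linarith [mul_le_mul_of_nonneg_left h hε]

/-- Theorem 1 of the paper: the exponential-kernel word-substitution mechanism
`Pr[M(x) = y] = exp(-½ε‖φ(x)-φ(y)‖) / ∑_{y'∈C} exp(-½ε‖φ(x)-φ(y')‖)`
satisfies metric differential privacy with respect to the
embedding-induced Euclidean distance. -/
theorem exp_kernel_mechanism_MDP
    {C : Type*} [Fintype C] [Nonempty C] (n : ℕ)
    (φ : C → EuclideanSpace ℝ (Fin n)) (ε : ℝ) (hε : 0 < ε)
    (x x' y : C) :
    Real.exp (-(1/2) * ε * ‖φ x - φ y‖) /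
        (∑ y' : C, Real.exp (-(1/2) * ε * ‖φ x - φ y'‖))
      ≤ Real.exp (ε * ‖φ x - φ x'‖) *
        (Real.exp (-(1/2) * ε * ‖φ x' - φ y‖) /
          (∑ y' : C, Real.exp (-(1/2) * ε * ‖φ x' - φ y'‖))) := by
  have sum_pos (a : C) : 0 < ∑ y' : C, Real.exp (-(1/2) * ε * ‖φ a - φ y'‖) :=
    Finset.sum_pos (fun _ _ => Real.exp_pos _) Finset.univ_nonempty
  have sum_le : ∑ y' : C, Real.exp (-(1/2) * ε * ‖φ x' - φ y'‖) ≤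
      Real.exp (1/2 * ε * ‖φ x - φ x'‖) * ∑ y' : C, Real.exp (-(1/2) * ε * ‖φ x - φ y'‖) := by
    rw [Finset.mul_sum, norm_sub_rev (φ x)]
    exact Finset.sum_le_sum fun y' _ => exp_kernel_le_mul hε.le (φ x') (φ x) (φ y')
  have exp_split : Real.exp (ε * ‖φ x - φ x'‖) =
      Real.exp (1/2 * ε * ‖φ x - φ x'‖) * Real.exp (1/2 * ε * ‖φ x - φ x'‖) := by
    rw [← Real.exp_add]
    ring_nf
  rw [← mul_div_assoc, div_le_div_iff₀ (sum_pos x) (sum_pos x'), exp_split]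
  refine (mul_le_mul (exp_kernel_le_mul hε.le (φ x) (φ x') (φ y)) sum_le
    (sum_pos x').le (by positivity)).trans_eq ?_
  ring
end

section
/- Let C be a finite nonempty set, and let d : C × C → ℝ be nonnegative, symmetric, and satisfy the triangle inequality (d(x,y) ≥ 0, d(x,y) = d(y,x), and d(x,z) ≤ d(x,y) + d(y,z) for all x, y, z ∈ C). Let ε > 0 and define p(x, y) = exp(-½·ε·d(x, y)) / (∑_{y' ∈ C} exp(-½·ε·d(x, y'))). Then for all x, x', y ∈ C, p(x, y) ≤ exp(ε·d(x, x')) · p(x', y). -/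
/-- If `u ≤ t + v`, the exponential kernel changes by at most the factor `exp (½ε·t)`. -/
theorem exp_neg_half_mul_le {ε t u v : ℝ} (hε : 0 ≤ ε) (h : u ≤ t + v) :
    Real.exp (-(1/2) * ε * v) ≤ Real.exp (1/2 * ε * t) * Real.exp (-(1/2) * ε * u) := by
  rw [← Real.exp_add, Real.exp_le_exp]
  linarith [mul_le_mul_of_nonneg_left h hε]

/-- Abstract form of Theorem 1: on a finite nonempty set `C` with a
pseudometric `d`, the exponential-kernel sampling distribution
`p(x,y) = exp(-½ε·d(x,y)) / ∑_{y'∈C} exp(-½ε·d(x,y'))`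
satisfies metric differential privacy:
`p(x,y) ≤ exp(ε·d(x,x')) · p(x',y)`. -/
theorem exp_kernel_MDP
    {C : Type*} [Fintype C] [Nonempty C]
    (d : C → C → ℝ)
    (hd_nonneg : ∀ x y, 0 ≤ d x y)
    (hd_symm : ∀ x y, d x y = d y x)
    (hd_triangle : ∀ x y z, d x z ≤ d x y + d y z)
    (ε : ℝ) (hε : 0 < ε)
    (x x' y : C) :
    Real.exp (-(1/2) * ε * d x y) /
        (∑ y' : C, Real.exp (-(1/2) * ε * d x y'))
      ≤ Real.exp (ε * d x x') *
        (Real.exp (-(1/2) * ε * d x' y) /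
          (∑ y' : C, Real.exp (-(1/2) * ε * d x' y'))) := by
  have hpos : ∀ a, 0 < ∑ y' : C, Real.exp (-(1/2) * ε * d a y') := fun a =>
    Finset.sum_pos (fun _ _ => Real.exp_pos _) Finset.univ_nonempty
  have hnum : Real.exp (-(1/2) * ε * d x y) ≤
      Real.exp (1/2 * ε * d x x') * Real.exp (-(1/2) * ε * d x' y) :=
    exp_neg_half_mul_le hε.le (hd_symm x' x ▸ hd_triangle x' x y)
  have hden : ∑ y' : C, Real.exp (-(1/2) * ε * d x' y') ≤
      Real.exp (1/2 * ε * d x x') * ∑ y' : C, Real.exp (-(1/2) * ε * d x y') := by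
    rw [Finset.mul_sum]
    exact Finset.sum_le_sum fun z _ => exp_neg_half_mul_le hε.le (hd_triangle x x' z)
  have hexp : Real.exp (ε * d x x') =
      Real.exp (1/2 * ε * d x x') * Real.exp (1/2 * ε * d x x') := by
    rw [← Real.exp_add]
    ring_nf
  rw [← mul_div_assoc, div_le_div_iff₀ (hpos x) (hpos x'), hexp]
  refine (mul_le_mul hnum hden (hpos x').le (by positivity)).trans_eq ?_
  ring
end
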